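/- (Sequential inverse-probability-weighting identity, proof of Lemma 1, condition (3).) For any function g : S^M → ℝ, almost everywhere E[ (Π_{j=1}^{M} p_j(Z_j) / e_{j,Z_j}) · g(Z_1, ..., Z_M) | F_0 ] equals the constant Σ_{(z_1,...,z_M) ∈ S^M} (Π_{j=1}^{M} p_j(z_j)) · g(z_1, ..., z_M), where for ω ∈ Ω the random denominator e_{j,Z_j}(ω) means e_{j,Z_j(ω)}(ω). -/

import Mathlib

open MeasureTheory
lemma ipw_aux_integrable {Ω : Type*} [F : MeasurableSpace Ω] (μ : Measure Ω)
    [IsProbabilityMeasure μ] (m : MeasurableSpace Ω) (hm : m ≤ F) (A : Set Ω)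
    (hA : MeasurableSet[F] A)
    (e W : Ω → ℝ) (he : e = μ[Set.indicator A (fun _ => (1 : ℝ)) | m])
    (hpos : ∀ᵐ ω ∂μ, 0 < e ω) (hWm : StronglyMeasurable[m] W) (hW : Integrable W μ) :
    Integrable (fun ω => W ω / e ω * Set.indicator A (fun _ => (1 : ℝ)) ω) μ ∧
    μ[fun ω => W ω / e ω * Set.indicator A (fun _ => (1 : ℝ)) ω | m] =ᵐ[μ] W := by
  have hem : StronglyMeasurable[m] e := by rw [he]; exact stronglyMeasurable_condExp
  have hei : Integrable e μ := by rw [he]; exact integrable_condExp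
  have hAi : Integrable (Set.indicator A (fun _ => (1 : ℝ))) μ :=
    (integrable_const (1 : ℝ)).indicator hA
  have hWe : StronglyMeasurable[m] (fun ω => W ω / e ω) :=
    (hWm.measurable.div hem.measurable).stronglyMeasurable
  have hmeas : (μ.restrict A).trim hm =
      (μ.trim hm).withDensity (fun ω => ENNReal.ofReal (e ω)) := by
    refine @Measure.ext _ m _ _ ?_
    intro s hs
    rw [trim_measurableSet_eq hm hs, withDensity_apply _ hs, restrict_trim hm _ hs,
      lintegral_trim hm hem.measurable.ennreal_ofReal,
      ← ofReal_integral_eq_lintegral_ofReal hei.integrableOn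
        (ae_restrict_of_ae (hpos.mono fun _ h => h.le)), he,
      setIntegral_condExp hm hAi hs, integral_indicator_const _ hA]
    simp [Measure.restrict_apply (hm s hs), measureReal_def, Measure.restrict_apply hA,
      Set.inter_comm]
  have hint : Integrable (fun ω => W ω / e ω * Set.indicator A (fun _ => (1 : ℝ)) ω) μ := by
    have h1 : IntegrableOn (fun ω => W ω / e ω) A μ := by
      refine ⟨(hWe.mono hm).aestronglyMeasurable, ?_⟩
      have hen : Measurable[m] (fun ω => ‖W ω / e ω‖ₑ) := hWe.measurable.enorm
      rw [hasFiniteIntegral_iff_enorm, ← lintegral_trim hm hen, hmeas,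
        lintegral_withDensity_eq_lintegral_mul _ hem.measurable.ennreal_ofReal hen,
        lintegral_trim hm (hem.measurable.ennreal_ofReal.mul hen)]
      have h2 := hW.2
      rw [hasFiniteIntegral_iff_enorm] at h2
      refine lt_of_le_of_lt (lintegral_mono_ae ?_) h2
      filter_upwards [hpos] with ω hω
      simp only [Pi.mul_apply]
      rw [← Real.enorm_of_nonneg hω.le, ← enorm_mul, mul_div_cancel₀ _ hω.ne']
    rw [← integrable_indicator_iff hA] at h1
    refine h1.congr (Filter.Eventually.of_forall fun ω => ?_)
    by_cases h : ω ∈ A <;> simp [h]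
  refine ⟨hint, ?_⟩
  have h3 := condExp_mul_of_stronglyMeasurable_left (μ := μ) hWe hint hAi
  refine h3.trans ?_
  rw [← he]
  filter_upwards [hpos] with ω hω
  simp only [Pi.mul_apply]
  exact div_mul_cancel₀ _ hω.ne'

lemma ipw_aux
    {Ω : Type*} [F : MeasurableSpace Ω] (μ : Measure Ω) [IsProbabilityMeasure μ]
    (ℱ : Filtration ℕ F)
    (S : Type*) [Fintype S] [MeasurableSpace S] [MeasurableSingletonClass S]
    (Z : ℕ → Ω → S) (e : ℕ → S → Ω → ℝ) (p : ℕ → S → ℝ) (M : ℕ)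
    (hZ : ∀ j, 1 ≤ j → j ≤ M → Measurable[ℱ j] (Z j))
    (he : ∀ j, 1 ≤ j → j ≤ M → ∀ z : S,
      e j z = μ[Set.indicator {ω | Z j ω = z} (fun _ => (1 : ℝ)) | ℱ (j - 1)])
    (hepos : ∀ j, 1 ≤ j → j ≤ M → ∀ z : S, ∀ᵐ ω ∂μ, 0 < e j z ω)
    (g : (Fin M → S) → ℝ) :
    Integrable (fun ω => (∏ j ∈ Finset.Icc 1 M, p j (Z j ω) / e j (Z j ω) ω) *
        g (fun j : Fin M => Z (j.val + 1) ω)) μ ∧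
    StronglyMeasurable[ℱ M] (fun ω => (∏ j ∈ Finset.Icc 1 M, p j (Z j ω) / e j (Z j ω) ω) *
        g (fun j : Fin M => Z (j.val + 1) ω)) ∧
    μ[fun ω => (∏ j ∈ Finset.Icc 1 M, p j (Z j ω) / e j (Z j ω) ω) *
        g (fun j : Fin M => Z (j.val + 1) ω) | ℱ 0]
      =ᵐ[μ] fun _ => ∑ z : Fin M → S, (∏ j : Fin M, p (j.val + 1) (z j)) * g z := by
  classical
  induction M with
  | zero =>
    have h0 : (fun ω => (∏ j ∈ Finset.Icc 1 0, p j (Z j ω) / e j (Z j ω) ω) *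
        g (fun j : Fin 0 => Z (j.val + 1) ω)) = fun _ => g default := by
      funext ω
      simp only [Finset.Icc_eq_empty (by norm_num : ¬ (1 ≤ 0)), Finset.prod_empty, one_mul]
      congr 1
      exact Subsingleton.elim _ _
    rw [h0]
    refine ⟨integrable_const _, stronglyMeasurable_const, ?_⟩
    rw [condExp_const (ℱ.le 0)]
    simp
  | succ M ih =>
    have ih' := ih (fun j h1 h2 => hZ j h1 (by omega)) (fun j h1 h2 => he j h1 (by omega))
      (fun j h1 h2 => hepos j h1 (by omega))
    clear ih
    set P : Ω → ℝ := fun ω => ∏ j ∈ Finset.Icc 1 M, p j (Z j ω) / e j (Z j ω) ω with hP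
    set Y : Ω → Fin M → S := fun ω j => Z (j.val + 1) ω with hY
    let gz : S → (Fin M → S) → ℝ := fun z y => p (M+1) z * g (Fin.snoc y z)
    let A : S → Set Ω := fun z => {ω | Z (M+1) ω = z}
    have hAm : ∀ z, MeasurableSet[ℱ (M+1)] (A z) := fun z =>
      hZ (M+1) (by omega) le_rfl (measurableSet_singleton z)
    have key := fun z => ipw_aux_integrable μ (ℱ M) (ℱ.le M) (A z) (ℱ.le _ _ (hAm z))
      (e (M+1) z) (fun ω => P ω * gz z (Y ω)) (he (M+1) (by omega) le_rfl z)
      (hepos (M+1) (by omega) le_rfl z) (ih' (gz z)).2.1 (ih' (gz z)).1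
    let T : S → Ω → ℝ := fun z ω =>
      P ω * gz z (Y ω) / e (M+1) z ω * Set.indicator (A z) (fun _ => (1 : ℝ)) ω
    have hX : (fun ω => (∏ j ∈ Finset.Icc 1 (M+1), p j (Z j ω) / e j (Z j ω) ω) *
        g (fun j : Fin (M+1) => Z (j.val + 1) ω)) = ∑ z, T z := by
      funext ω
      rw [Finset.sum_apply, Finset.sum_eq_single (Z (M+1) ω)]
      · have hs : (fun j : Fin (M+1) => Z (j.val + 1) ω) = Fin.snoc (Y ω) (Z (M+1) ω) := by
          funext j
          refine Fin.lastCases ?_ (fun i => ?_) j <;> simp [hY]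
        rw [hs, Finset.prod_Icc_succ_top (by omega)]
        simp only [T, gz, A, hP, Set.indicator, Set.mem_setOf_eq, if_true]
        ring
      · intro z _ hz
        simp [T, A, hz.symm]
      · simp
    rw [hX]
    have hTi : ∀ z, Integrable (T z) μ := fun z => (key z).1
    have hTm : ∀ z, StronglyMeasurable[ℱ (M+1)] (T z) := by
      intro z
      have h1 := (ih' (gz z)).2.1.mono (ℱ.mono (Nat.le_succ M))
      have h2 : StronglyMeasurable[ℱ (M+1)] (e (M+1) z) := by
        rw [he (M+1) (by omega) le_rfl z]
        exact stronglyMeasurable_condExp.mono (ℱ.mono (by omega))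
      exact ((h1.measurable.div h2.measurable).mul
        (measurable_const.indicator (hAm z))).stronglyMeasurable
    refine ⟨integrable_finsetSum' _ fun z _ => hTi z,
      Finset.stronglyMeasurable_sum _ fun z _ => hTm z, ?_⟩
    have h1 : μ[∑ z, T z | ℱ M] =ᵐ[μ] fun ω => P ω * (∑ z, gz z (Y ω)) := by
      refine (condExp_finsetSum (fun z _ => hTi z) _).trans ?_
      have hall : ∀ᵐ ω ∂μ, ∀ z, (μ[T z | ℱ M]) ω = P ω * gz z (Y ω) :=
        ae_all_iff.2 fun z => (key z).2
      filter_upwards [hall] with ω hω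
      rw [Finset.sum_apply, Finset.mul_sum]
      exact Finset.sum_congr rfl fun z _ => hω z
    have h2 := condExp_condExp_of_le (μ := μ) (f := ∑ z, T z) (ℱ.mono (Nat.zero_le M)) (ℱ.le M)
    refine h2.symm.trans ((condExp_congr_ae h1).trans ?_)
    refine (ih' (fun y => ∑ z, gz z y)).2.2.trans (Filter.Eventually.of_forall fun _ => ?_)
    simp only
    rw [← (Fin.snocEquiv (fun _ : Fin (M+1) => S)).sum_comp, Fintype.sum_prod_type_right]
    refine Finset.sum_congr rfl fun y _ => ?_
    rw [Finset.mul_sum]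
    refine Finset.sum_congr rfl fun z _ => ?_
    rw [Fin.prod_univ_castSucc]
    simp [Fin.snocEquiv, gz]
    ring


open MeasureTheory

/-- Sequential inverse-probability-weighting identity (proof of Lemma 1, condition (3)):
for any `g : S^M → ℝ`, a.e.,
`E[ (∏_{j=1}^{M} p_j(Z_j)/e_{j,Z_j}) · g(Z_1,…,Z_M) | F_0 ]
  = ∑_{(z_1,…,z_M) ∈ S^M} (∏_{j=1}^{M} p_j(z_j)) · g(z_1,…,z_M)`. -/
theorem ipw_sequential_identity
    {Ω : Type*} [F : MeasurableSpace Ω] (μ : Measure Ω) [IsProbabilityMeasure μ]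
    (ℱ : Filtration ℕ F) (M : ℕ)
    (S : Type*) [Fintype S] [Nonempty S] [MeasurableSpace S] [MeasurableSingletonClass S]
    (Z : ℕ → Ω → S) (hZ : ∀ j, 1 ≤ j → j ≤ M → Measurable[ℱ j] (Z j))
    (e : ℕ → S → Ω → ℝ)
    (he : ∀ j, 1 ≤ j → j ≤ M → ∀ z : S,
      e j z = μ[Set.indicator {ω | Z j ω = z} (fun _ => (1 : ℝ)) | ℱ (j - 1)])
    (hepos : ∀ j, 1 ≤ j → j ≤ M → ∀ z : S, ∀ᵐ ω ∂μ, 0 < e j z ω)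
    (p : ℕ → S → ℝ) (hp : ∀ j z, 0 ≤ p j z) (hpsum : ∀ j, ∑ z : S, p j z = 1)
    (g : (Fin M → S) → ℝ) :
    μ[fun ω => (∏ j ∈ Finset.Icc 1 M, p j (Z j ω) / e j (Z j ω) ω) *
        g (fun j : Fin M => Z (j.val + 1) ω) | ℱ 0]
      =ᵐ[μ] fun _ => ∑ z : Fin M → S, (∏ j : Fin M, p (j.val + 1) (z j)) * g z := by
  exact (ipw_aux μ ℱ S Z e p M hZ he hepos g).2.2
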